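/- (Second-order (ε,δ,R)-optimum threshold, general formula.) For any general source X, any R ≥ 0, and any ε, δ ∈ [0,1) satisfying ε + δ < 1, it holds that L(ε,δ,R|X) = G_{ε,δ}(R|X). -/

import Mathlib

open Filter MeasureTheory

namespace NY

/-- A probability distribution on a set, given by its point mass function. -/
structure Dist (α : Type*) where
  p : α → ℝ
  nonneg : ∀ x, 0 ≤ p x
  hasSum : HasSum p 1

/-- The probability of a set under a distribution. -/
noncomputable def Dist.pr {α : Type*} (P : Dist α) (A : Set α) : ℝ := ∑' x : A, P.p x.1

/-- 𝒰* : nonempty finite strings over the code alphabet 𝒰 = {1,…,K}. -/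
abbrev Word (K : ℕ) := {u : List (Fin K) // u ≠ []}

/-- Length of a string, as a real number. -/
noncomputable def wlen {K : ℕ} (u : Word K) : ℝ := u.1.length

/-- Error probability of a variable-length code (φ, ψ). -/
noncomputable def errP {α : Type*} {K : ℕ} (P : Dist α) (φ : α → Word K) (ψ : Word K → α) : ℝ :=
  P.pr {x | ψ (φ x) ≠ x}

/-- Overflow probability of an encoder φ with threshold η. -/
noncomputable def ovP {α : Type*} {K : ℕ} (P : Dist α) (φ : α → Word K) (η : ℝ) : ℝ :=
  P.pr {x | wlen (φ x) > η}

/-- A general source: for each blocklength n, a distribution on 𝒳^n. -/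
abbrev Source (𝒳 : Type*) := (n : ℕ) → Dist (Fin n → 𝒳)

/-- The limit as ν ↓ 0 of a function g which is nonincreasing in ν
(the limit exists by monotonicity and equals the supremum over ν > 0). -/
noncomputable def limNu (g : ℝ → ℝ) : ℝ := sSup (g '' Set.Ioi (0 : ℝ))

variable {𝒳 : Type*}

/-- A rate R ≥ 0 is (ε,δ)-achievable. -/
def FirstAch (K : ℕ) (X : Source 𝒳) (ε δ R : ℝ) : Prop :=
  0 ≤ R ∧ ∃ (φ : ∀ n, (Fin n → 𝒳) → Word K) (ψ : ∀ n, Word K → (Fin n → 𝒳)),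
    limsup (fun n => errP (X n) (φ n) (ψ n)) atTop ≤ ε ∧
    limsup (fun n => ovP (X n) (φ n) ((n : ℝ) * R)) atTop ≤ δ

/-- The first-order (ε,δ)-optimum threshold R(ε,δ|X). -/
noncomputable def Ropt (K : ℕ) (X : Source 𝒳) (ε δ : ℝ) : ℝ :=
  sInf {R | FirstAch K X ε δ R}

/-- L is (ε,δ,R)-achievable (second order). -/
def SecondAch (K : ℕ) (X : Source 𝒳) (ε δ R L : ℝ) : Prop :=
  ∃ (φ : ∀ n, (Fin n → 𝒳) → Word K) (ψ : ∀ n, Word K → (Fin n → 𝒳)),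
    limsup (fun n => errP (X n) (φ n) (ψ n)) atTop ≤ ε ∧
    limsup (fun n => ovP (X n) (φ n) ((n : ℝ) * R + Real.sqrt (n : ℝ) * L)) atTop ≤ δ

/-- The second-order (ε,δ,R)-optimum threshold L(ε,δ,R|X). -/
noncomputable def Lopt (K : ℕ) (X : Source 𝒳) (ε δ R : ℝ) : ℝ :=
  sInf {L | SecondAch K X ε δ R L}

/-- A rate R ≥ 0 is optimistically (ε,δ)-achievable. -/
def OptFirstAch (K : ℕ) (X : Source 𝒳) (ε δ R : ℝ) : Prop :=
  0 ≤ R ∧ ∃ (φ : ∀ n, (Fin n → 𝒳) → Word K) (ψ : ∀ n, Word K → (Fin n → 𝒳)),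
    ∀ γ > (0 : ℝ), ∃ ns : ℕ → ℕ, StrictMono ns ∧ ∀ i,
      errP (X (ns i)) (φ (ns i)) (ψ (ns i)) ≤ ε + γ ∧
      ovP (X (ns i)) (φ (ns i)) ((ns i : ℝ) * R) ≤ δ + γ

/-- The optimistic first-order (ε,δ)-optimum threshold R*(ε,δ|X). -/
noncomputable def RoptStar (K : ℕ) (X : Source 𝒳) (ε δ : ℝ) : ℝ :=
  sInf {R | OptFirstAch K X ε δ R}

/-- L is optimistically (ε,δ,R)-achievable. -/
def OptSecondAch (K : ℕ) (X : Source 𝒳) (ε δ R L : ℝ) : Prop :=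
  ∃ (φ : ∀ n, (Fin n → 𝒳) → Word K) (ψ : ∀ n, Word K → (Fin n → 𝒳)),
    ∀ γ > (0 : ℝ), ∃ ns : ℕ → ℕ, StrictMono ns ∧ ∀ i,
      errP (X (ns i)) (φ (ns i)) (ψ (ns i)) ≤ ε + γ ∧
      ovP (X (ns i)) (φ (ns i)) ((ns i : ℝ) * R + Real.sqrt (ns i : ℝ) * L) ≤ δ + γ

/-- The optimistic second-order (ε,δ,R)-optimum threshold L*(ε,δ,R|X). -/
noncomputable def LoptStar (K : ℕ) (X : Source 𝒳) (ε δ R : ℝ) : ℝ :=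
  sInf {L | OptSecondAch K X ε δ R L}

/-- A rate R ≥ 0 is type I (ε,δ)-achievable. -/
def TypeIAch (K : ℕ) (X : Source 𝒳) (ε δ R : ℝ) : Prop :=
  0 ≤ R ∧ ∃ (φ : ∀ n, (Fin n → 𝒳) → Word K) (ψ : ∀ n, Word K → (Fin n → 𝒳)),
    limsup (fun n => errP (X n) (φ n) (ψ n)) atTop ≤ ε ∧
    liminf (fun n => ovP (X n) (φ n) ((n : ℝ) * R)) atTop ≤ δ

/-- R†(ε,δ|X). -/
noncomputable def Rdagger (K : ℕ) (X : Source 𝒳) (ε δ : ℝ) : ℝ :=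
  sInf {R | TypeIAch K X ε δ R}

/-- A rate R ≥ 0 is type II (ε,δ)-achievable. -/
def TypeIIAch (K : ℕ) (X : Source 𝒳) (ε δ R : ℝ) : Prop :=
  0 ≤ R ∧ ∃ (φ : ∀ n, (Fin n → 𝒳) → Word K) (ψ : ∀ n, Word K → (Fin n → 𝒳)),
    liminf (fun n => errP (X n) (φ n) (ψ n)) atTop ≤ ε ∧
    limsup (fun n => ovP (X n) (φ n) ((n : ℝ) * R)) atTop ≤ δ

/-- R‡(ε,δ|X). -/
noncomputable def Rddagger (K : ℕ) (X : Source 𝒳) (ε δ : ℝ) : ℝ :=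
  sInf {R | TypeIIAch K X ε δ R}

/-- H̄_γ(X) := inf{ R : limsup_n Pr{ (1/n) log(1/P_{X^n}(X^n)) > R } ≤ γ }. -/
noncomputable def Hbar (K : ℕ) (X : Source 𝒳) (γ : ℝ) : ℝ :=
  sInf {R | limsup (fun n =>
    (X n).pr {x | Real.logb (K : ℝ) (1 / (X n).p x) / (n : ℝ) > R}) atTop ≤ γ}

/-- H̄*_γ(X) (optimistic version, with liminf). -/
noncomputable def HbarStar (K : ℕ) (X : Source 𝒳) (γ : ℝ) : ℝ :=
  sInf {R | liminf (fun n =>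
    (X n).pr {x | Real.logb (K : ℝ) (1 / (X n).p x) / (n : ℝ) > R}) atTop ≤ γ}

/-- H̄_γ(R|X) := inf{ L : limsup_n Pr{ (1/n) log(1/P_{X^n}(X^n)) > R + L/√n } ≤ γ }. -/
noncomputable def Hbar2 (K : ℕ) (X : Source 𝒳) (γ R : ℝ) : ℝ :=
  sInf {L | limsup (fun n =>
    (X n).pr {x | Real.logb (K : ℝ) (1 / (X n).p x) / (n : ℝ)
      > R + L / Real.sqrt (n : ℝ)}) atTop ≤ γ}

/-- H̄*_γ(R|X) (optimistic version, with liminf). -/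
noncomputable def Hbar2Star (K : ℕ) (X : Source 𝒳) (γ R : ℝ) : ℝ :=
  sInf {L | liminf (fun n =>
    (X n).pr {x | Real.logb (K : ℝ) (1 / (X n).p x) / (n : ℝ)
      > R + L / Real.sqrt (n : ℝ)}) atTop ≤ γ}

/-- F(ε,R) := limsup_n inf_{A : Pr(A) ≥ 1−ε} Pr{ −(1/n) log P_{X^n}(X^n) ≥ R, X^n ∈ A }. -/
noncomputable def Fspec (K : ℕ) (X : Source 𝒳) (ε R : ℝ) : ℝ :=
  limsup (fun n =>
    sInf ((fun A : Set (Fin n → 𝒳) =>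
        (X n).pr (A ∩ {x | -Real.logb (K : ℝ) ((X n).p x) / (n : ℝ) ≥ R})) ''
      {A | (X n).pr A ≥ 1 - ε})) atTop

/-- H̃_{ε,δ}(X) := inf{ R : F(ε,R) ≤ δ }. -/
noncomputable def Htilde (K : ℕ) (X : Source 𝒳) (ε δ : ℝ) : ℝ :=
  sInf {R | Fspec K X ε R ≤ δ}

/-- G_{ε,δ}(X). -/
noncomputable def Gfirst (K : ℕ) (X : Source 𝒳) (ε δ : ℝ) : ℝ :=
  sInf {R | limNu (fun ν => limsup (fun n =>
    sInf ((fun A : Set (Fin n → 𝒳) =>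
        (X n).pr (A ∩ {x | -Real.logb (K : ℝ) ((X n).p x / (X n).pr A) / (n : ℝ) ≥ R})) ''
      {A | (X n).pr A ≥ 1 - ε - ν})) atTop) ≤ δ}

/-- G*_{ε,δ}(X) (optimistic version, with liminf). -/
noncomputable def GfirstStar (K : ℕ) (X : Source 𝒳) (ε δ : ℝ) : ℝ :=
  sInf {R | limNu (fun ν => liminf (fun n =>
    sInf ((fun A : Set (Fin n → 𝒳) =>
        (X n).pr (A ∩ {x | -Real.logb (K : ℝ) ((X n).p x / (X n).pr A) / (n : ℝ) ≥ R})) ''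
      {A | (X n).pr A ≥ 1 - ε - ν})) atTop) ≤ δ}

/-- G_{ε,δ}(R|X). -/
noncomputable def Gsecond (K : ℕ) (X : Source 𝒳) (ε δ R : ℝ) : ℝ :=
  sInf {L | limNu (fun ν => limsup (fun n =>
    sInf ((fun A : Set (Fin n → 𝒳) =>
        (X n).pr (A ∩ {x | -Real.logb (K : ℝ) ((X n).p x / (X n).pr A) / (n : ℝ)
          ≥ R + L / Real.sqrt (n : ℝ)})) ''
      {A | (X n).pr A ≥ 1 - ε - ν})) atTop) ≤ δ}

/-- G*_{ε,δ}(R|X) (optimistic version, with liminf). -/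
noncomputable def GsecondStar (K : ℕ) (X : Source 𝒳) (ε δ R : ℝ) : ℝ :=
  sInf {L | limNu (fun ν => liminf (fun n =>
    sInf ((fun A : Set (Fin n → 𝒳) =>
        (X n).pr (A ∩ {x | -Real.logb (K : ℝ) ((X n).p x / (X n).pr A) / (n : ℝ)
          ≥ R + L / Real.sqrt (n : ℝ)})) ''
      {A | (X n).pr A ≥ 1 - ε - ν})) atTop) ≤ δ}

/-- A rate R is optimistically ε-achievable by fixed-length codes. -/
def FixAchR (K : ℕ) (X : Source 𝒳) (ε R : ℝ) : Prop :=
  ∃ (M : ℕ → ℕ) (φ : ∀ n, (Fin n → 𝒳) → Fin (M n)) (ψ : ∀ n, Fin (M n) → (Fin n → 𝒳)),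
    ∀ γ > (0 : ℝ), ∃ ns : ℕ → ℕ, StrictMono ns ∧ ∀ i,
      (X (ns i)).pr {x | ψ (ns i) (φ (ns i) x) ≠ x} ≤ ε + γ ∧
      Real.logb (K : ℝ) (M (ns i) : ℝ) / (ns i : ℝ) ≤ R + γ

/-- R^f(ε|X). -/
noncomputable def Rfix (K : ℕ) (X : Source 𝒳) (ε : ℝ) : ℝ :=
  sInf {R | FixAchR K X ε R}

/-- A real L is optimistically (ε,R)-achievable by fixed-length codes. -/
def FixAchL (K : ℕ) (X : Source 𝒳) (ε R L : ℝ) : Prop :=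
  ∃ (M : ℕ → ℕ) (φ : ∀ n, (Fin n → 𝒳) → Fin (M n)) (ψ : ∀ n, Fin (M n) → (Fin n → 𝒳)),
    ∀ γ > (0 : ℝ), ∃ ns : ℕ → ℕ, StrictMono ns ∧ ∀ i,
      (X (ns i)).pr {x | ψ (ns i) (φ (ns i) x) ≠ x} ≤ ε + γ ∧
      Real.logb (K : ℝ) ((M (ns i) : ℝ) / (K : ℝ) ^ ((ns i : ℝ) * R)) / Real.sqrt (ns i : ℝ)
        ≤ L + γ

/-- L^f(ε,R|X). -/
noncomputable def Lfix (K : ℕ) (X : Source 𝒳) (ε R : ℝ) : ℝ :=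
  sInf {L | FixAchL K X ε R L}

section helpers
variable {α : Type*}

lemma Dist.summ (P : Dist α) : Summable P.p := P.hasSum.summable

lemma pr_eq (P : Dist α) (A : Set α) : P.pr A = ∑' x, A.indicator P.p x := by
  unfold Dist.pr; exact tsum_subtype A P.p

lemma pr_nonneg (P : Dist α) (A : Set α) : 0 ≤ P.pr A :=
  tsum_nonneg (fun x => P.nonneg x.1)

lemma pr_mono (P : Dist α) {A B : Set α} (h : A ⊆ B) : P.pr A ≤ P.pr B := by
  rw [pr_eq, pr_eq]
  exact Summable.tsum_le_tsum (fun x => Set.indicator_le_indicator_of_subset h P.nonneg x)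
    (P.summ.indicator A) (P.summ.indicator B)

lemma pr_univ (P : Dist α) : P.pr Set.univ = 1 := by
  rw [pr_eq]; simpa using P.hasSum.tsum_eq

lemma pr_le_one (P : Dist α) (A : Set α) : P.pr A ≤ 1 := by
  rw [← pr_univ P]; exact pr_mono P (Set.subset_univ A)

lemma pr_union_le (P : Dist α) (A B : Set α) : P.pr (A ∪ B) ≤ P.pr A + P.pr B := by
  rw [pr_eq, pr_eq, pr_eq, ← Summable.tsum_add (P.summ.indicator A) (P.summ.indicator B)]
  refine Summable.tsum_le_tsum (fun x => ?_) (P.summ.indicator _)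
    ((P.summ.indicator A).add (P.summ.indicator B))
  have := P.nonneg x
  by_cases ha : x ∈ A <;> by_cases hb : x ∈ B <;> simp [Set.indicator, ha, hb, this]

lemma pr_compl (P : Dist α) (A : Set α) : P.pr A + P.pr Aᶜ = 1 := by
  rw [pr_eq, pr_eq, ← Summable.tsum_add (P.summ.indicator A) (P.summ.indicator _)]
  rw [← P.hasSum.tsum_eq]
  refine tsum_congr (fun x => ?_)
  by_cases ha : x ∈ A <;> simp [Set.indicator, ha]

lemma pr_null (P : Dist α) : P.pr {x | P.p x = 0} = 0 := by
  rw [pr_eq]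
  convert tsum_zero with x
  by_cases h : P.p x = 0 <;> simp [Set.indicator, h]

lemma p_le_pr (P : Dist α) {A : Set α} {x : α} (hx : x ∈ A) : P.p x ≤ P.pr A := by
  rw [pr_eq]
  have := (P.summ.indicator A).le_tsum x (fun y _ => Set.indicator_nonneg (fun z _ => P.nonneg z) y)
  simpa [Set.indicator, hx] using this

lemma sum_le_pr (P : Dist α) {A : Set α} (F : Finset α) (h : (F : Set α) ⊆ A) :
    ∑ x ∈ F, P.p x ≤ P.pr A := by
  rw [pr_eq]
  have := (P.summ.indicator A).sum_le_tsum F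
    (fun y _ => Set.indicator_nonneg (fun z _ => P.nonneg z) y)
  refine le_trans (le_of_eq ?_) this
  refine Finset.sum_congr rfl (fun x hx => ?_)
  have : x ∈ A := h (by simpa using hx)
  simp [Set.indicator, this]

lemma pr_le_card (P : Dist α) (C : Set α) (hC : C.Finite) (q : ℝ) (h : ∀ x ∈ C, P.p x ≤ q) :
    P.pr C ≤ C.ncard * q := by
  have : P.pr C = ∑ x ∈ hC.toFinset, P.p x := by
    have h2 := Finset.tsum_subtype' hC.toFinset P.p
    rw [← h2, Dist.pr, hC.coe_toFinset]
  rw [this, Set.ncard_eq_toFinset_card C hC, ← nsmul_eq_mul]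
  exact Finset.sum_le_card_nsmul _ _ _ (fun x hx => h x (by simpa using hx))

lemma finite_of_lower (P : Dist α) {A B : Set α} (hBA : B ⊆ A) (hA : 0 < P.pr A) (M : ℝ)
    (hM : 0 < M) (h : ∀ x ∈ B, P.pr A / M ≤ P.p x) : B.Finite ∧ (B.ncard : ℝ) ≤ M := by
  have key : ∀ F : Finset α, (F : Set α) ⊆ B → (F.card : ℝ) ≤ M := by
    intro F hF
    have h1 := sum_le_pr P F (hF.trans hBA)
    have h2 : F.card • (P.pr A / M) ≤ ∑ x ∈ F, P.p x :=
      Finset.card_nsmul_le_sum _ _ _ (fun x hx => h x (hF (by simpa using hx)))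
    rw [nsmul_eq_mul] at h2
    have h3 : (F.card : ℝ) * (P.pr A / M) ≤ P.pr A := h2.trans h1
    rw [mul_div_assoc', div_le_iff₀ hM, mul_comm] at h3
    exact le_of_mul_le_mul_left h3 hA
  have hfin : B.Finite := by
    by_contra hinf
    obtain ⟨F, hF, hc⟩ := Set.Infinite.exists_subset_card_eq hinf (⌈M⌉₊ + 1)
    have := key F hF
    rw [hc] at this
    have h4 := Nat.le_ceil M
    push_cast at this
    linarith
  refine ⟨hfin, ?_⟩
  rw [Set.ncard_eq_toFinset_card B hfin]
  exact key _ (by simp)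

lemma limsup_le_iff' (u : ℕ → ℝ) (h0 : ∀ n, 0 ≤ u n) (h1 : ∀ n, u n ≤ 1) (c : ℝ) :
    limsup u atTop ≤ c ↔ ∀ η > 0, ∀ᶠ n in atTop, u n ≤ c + η := by
  have hb : IsBoundedUnder (· ≤ ·) atTop u := isBoundedUnder_of ⟨1, h1⟩
  have hb' : IsBoundedUnder (· ≥ ·) atTop u := isBoundedUnder_of ⟨0, h0⟩
  constructor
  · intro h η hη
    have : limsup u atTop < c + η := by linarith
    exact (eventually_lt_of_limsup_lt this hb).mono (fun n hn => hn.le)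
  · intro h
    refine le_of_forall_pos_le_add (fun η hη => ?_)
    exact limsup_le_of_le hb'.isCoboundedUnder_le (h η hη)

/-- the spectral event -/
lemma cond_iff (K : ℕ) (hK : 2 ≤ K) (n : ℕ) (hn : 1 ≤ n) (R L p a : ℝ) (hp : 0 < p) (ha : 0 < a) :
    (-Real.logb (K : ℝ) (p / a) / (n : ℝ) ≥ R + L / Real.sqrt (n : ℝ)) ↔
      p ≤ a / (K : ℝ) ^ ((n : ℝ) * R + Real.sqrt (n : ℝ) * L) := by
  have hK1 : (1 : ℝ) < K := by exact_mod_cast (by omega : 1 < K)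
  have hn0 : (0 : ℝ) < n := by exact_mod_cast hn
  have hs : 0 < Real.sqrt (n : ℝ) := Real.sqrt_pos.2 hn0
  have hsq : Real.sqrt (n : ℝ) * Real.sqrt (n : ℝ) = n := Real.mul_self_sqrt hn0.le
  have e : (R + L / Real.sqrt (n : ℝ)) * n = n * R + Real.sqrt (n : ℝ) * L := by
    have : L / Real.sqrt (n : ℝ) * n = Real.sqrt (n : ℝ) * L := by
      rw [div_mul_eq_mul_div, div_eq_iff hs.ne', mul_right_comm, hsq]; ring
    rw [add_mul, this]; ring
  rw [ge_iff_le, le_div_iff₀ hn0, e, le_neg, Real.logb_le_iff_le_rpow hK1 (div_pos hp ha),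
    Real.rpow_neg (by linarith), div_le_iff₀ ha, div_eq_mul_inv, mul_comm a]

end helpers

noncomputable def Gset {α : Type*} (K n : ℕ) (P : Dist α) (R L : ℝ) (A : Set α) : Set α :=
  A ∩ {x | -Real.logb (K : ℝ) (P.p x / P.pr A) / (n : ℝ) ≥ R + L / Real.sqrt (n : ℝ)}

noncomputable def gfun {α : Type*} (K n : ℕ) (P : Dist α) (ε ν R L : ℝ) : ℝ :=
  sInf ((fun A : Set α => P.pr (Gset K n P R L A)) '' {A | P.pr A ≥ 1 - ε - ν})

section g
variable {α : Type*}

lemma gfun_nonneg (K n : ℕ) (P : Dist α) (ε ν R L : ℝ) : 0 ≤ gfun K n P ε ν R L := by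
  refine Real.sInf_nonneg ?_
  rintro _ ⟨A, -, rfl⟩
  exact pr_nonneg _ _

lemma gfun_le (K n : ℕ) (P : Dist α) (ε ν R L : ℝ) (A : Set α) (hA : P.pr A ≥ 1 - ε - ν) :
    gfun K n P ε ν R L ≤ P.pr (Gset K n P R L A) := by
  refine csInf_le ⟨0, ?_⟩ ⟨A, hA, rfl⟩
  rintro _ ⟨A, -, rfl⟩
  exact pr_nonneg _ _

lemma gfun_exists (K n : ℕ) (P : Dist α) (ε ν R L c : ℝ) (hε : 0 ≤ ε) (hν : 0 ≤ ν)
    (h : gfun K n P ε ν R L < c) :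
    ∃ A : Set α, P.pr A ≥ 1 - ε - ν ∧ P.pr (Gset K n P R L A) < c := by
  have hne : ((fun A : Set α => P.pr (Gset K n P R L A)) '' {A | P.pr A ≥ 1 - ε - ν}).Nonempty :=
    ⟨_, Set.univ, by simp only [Set.mem_ofPred_eq, pr_univ]; linarith, rfl⟩
  obtain ⟨_, ⟨A, hA, rfl⟩, hc⟩ := exists_lt_of_csInf_lt hne h
  exact ⟨A, hA, hc⟩

lemma gfun_le_one (K n : ℕ) (P : Dist α) (ε ν R L : ℝ) (hε : 0 ≤ ε) (hν : 0 ≤ ν) :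
    gfun K n P ε ν R L ≤ 1 :=
  (gfun_le K n P ε ν R L Set.univ (by rw [pr_univ]; linarith)).trans (pr_le_one _ _)

lemma gsec_iff {𝒳 : Type*} (K : ℕ) (X : Source 𝒳) (R ε δ L : ℝ) (hε0 : 0 ≤ ε) :
    limNu (fun ν => limsup (fun n => gfun K n (X n) ε ν R L) atTop) ≤ δ ↔
      ∀ ν > 0, ∀ᶠ n in atTop, gfun K n (X n) ε ν R L ≤ δ + ν := by
  have h01 : ∀ ν > 0, (limsup (fun n => gfun K n (X n) ε ν R L) atTop ≤ δ ↔
      ∀ η > 0, ∀ᶠ n in atTop, gfun K n (X n) ε ν R L ≤ δ + η) := fun ν hν =>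
    limsup_le_iff' _ (fun n => gfun_nonneg _ _ _ _ _ _ _)
      (fun n => gfun_le_one _ _ _ _ _ _ _ hε0 (le_of_lt hν)) δ
  have hbd : ∀ ν > 0, limsup (fun n => gfun K n (X n) ε ν R L) atTop ≤ 1 := fun ν hν =>
    (limsup_le_iff' _ (fun n => gfun_nonneg _ _ _ _ _ _ _)
      (fun n => gfun_le_one _ _ _ _ _ _ _ hε0 (le_of_lt hν)) 1).2 (fun η hη =>
        Eventually.of_forall (fun n => by
          have := gfun_le_one K n (X n) ε ν R L hε0 (le_of_lt hν); linarith))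
  unfold limNu
  constructor
  · intro h ν hν
    have : limsup (fun n => gfun K n (X n) ε ν R L) atTop ≤ δ := by
      refine le_trans (le_csSup (a := limsup (fun n => gfun K n (X n) ε ν R L) atTop) ⟨1, ?_⟩
        (Set.mem_image_of_mem (fun ν => limsup (fun n => gfun K n (X n) ε ν R L) atTop)
          (Set.mem_Ioi.2 hν))) h
      rintro _ ⟨ν', hν', rfl⟩
      exact hbd ν' hν'
    exact (h01 ν hν).1 this ν hν
  · intro h
    refine csSup_le ⟨_, 1, by simp, rfl⟩ ?_
    rintro _ ⟨ν, hν, rfl⟩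
    refine (h01 ν hν).2 (fun η hη => ?_)
    have hν' : 0 < ν := hν
    filter_upwards [h (min ν η) (lt_min hν' hη)] with n hn
    refine le_trans ?_ (hn.trans (by have := min_le_right ν η; linarith))
    refine le_csInf ⟨_, Set.univ, by
      simp only [Set.mem_ofPred_eq, pr_univ]; have := lt_min hν' hη; linarith, rfl⟩ ?_
    rintro _ ⟨A, hA, rfl⟩
    refine gfun_le _ _ _ _ _ _ _ _ ?_
    have hA' : (X n).pr A ≥ 1 - ε - min ν η := hA
    have := min_le_left ν η; linarith

end g

section codes
variable {α : Type*}

lemma code_exists [Countable α] [Nonempty α] (K : ℕ) (hK : 2 ≤ K) (A B : Set α) (hBA : B ⊆ A)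
    (hfin : B.Finite) (m : ℕ) (hm : 1 ≤ m) (hc : B.ncard ≤ K ^ m) :
    ∃ (φ : α → Word K) (ψ : Word K → α), (∀ x ∈ A, ψ (φ x) = x) ∧
      ∀ x, m < (φ x).1.length → x ∈ A \ B := by
  classical
  haveI := hfin.fintype
  obtain ⟨e, he⟩ := exists_injective_nat α
  have hcard : Fintype.card B ≤ Fintype.card (List.Vector (Fin K) m) := by
    rw [card_vector, Fintype.card_fin, ← Nat.card_eq_fintype_card, Nat.card_coe_set_eq]
    exact hc
  obtain ⟨f⟩ := Function.Embedding.nonempty_of_card_le hcard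
  let z : Fin K := ⟨0, by omega⟩
  have hne : ∀ v : List.Vector (Fin K) m, v.1 ≠ [] := by
    intro v hv
    have := v.2
    rw [hv] at this
    simp at this
    omega
  let φ : α → Word K := fun x =>
    if h : x ∈ B then ⟨(f ⟨x, h⟩).1, hne _⟩
    else if x ∈ A then ⟨List.replicate (m + 1 + e x) z, by simp⟩
    else ⟨List.replicate m z, by simp; omega⟩
  have hlB : ∀ x ∈ B, (φ x).1.length = m := by
    intro x hx
    simp only [φ, hx, dif_pos]
    exact (f ⟨x, hx⟩).2
  have hlA : ∀ x, x ∉ B → x ∈ A → (φ x).1.length = m + 1 + e x := by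
    intro x hx hA
    simp [φ, hx, hA]
  have hlC : ∀ x, x ∉ B → x ∉ A → (φ x).1.length = m := by
    intro x hx hA
    simp [φ, hx, hA]
  have hinj : Set.InjOn φ A := by
    intro x hx y hy hxy
    by_cases hxB : x ∈ B <;> by_cases hyB : y ∈ B
    · simp only [φ, hxB, hyB, dif_pos, Subtype.mk.injEq] at hxy
      have := f.injective (Subtype.ext hxy)
      simpa using this
    · have h1 := hlB x hxB
      have h2 := hlA y hyB hy
      rw [hxy] at h1; omega
    · have h1 := hlB y hyB
      have h2 := hlA x hxB hx
      rw [hxy] at h2; omega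
    · have h1 := hlA y hyB hy
      have h2 := hlA x hxB hx
      rw [hxy] at h2
      exact he (by omega)
  refine ⟨φ, Function.invFunOn φ A, fun x hx => hinj.leftInvOn_invFunOn hx, ?_⟩
  intro x hx
  by_cases hxB : x ∈ B
  · have := hlB x hxB; omega
  · by_cases hxA : x ∈ A
    · exact ⟨hxA, hxB⟩
    · have := hlC x hxB hxA; omega

lemma count_words (K : ℕ) (hK : 2 ≤ K) (φ : α → Word K) (C : Set α) (hinj : Set.InjOn φ C)
    (t : ℝ) (hC : ∀ x ∈ C, wlen (φ x) ≤ t) :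
    C.Finite ∧ (C.ncard : ℝ) ≤ (K : ℝ) ^ (t + 1) := by
  classical
  have hK1 : (1 : ℝ) < K := by exact_mod_cast (by omega : 1 < K)
  rcases lt_or_ge t 0 with ht | ht
  · have : C = ∅ := by
      ext x
      simp only [Set.mem_empty_iff_false, iff_false]
      intro hx
      have h1 := hC x hx
      have h2 : (0 : ℝ) ≤ wlen (φ x) := Nat.cast_nonneg _
      linarith
    subst this
    refine ⟨Set.finite_empty, ?_⟩
    simp only [Set.ncard_empty, Nat.cast_zero]
    positivity
  · set m := ⌊t⌋₊ with hm
    have hlen : ∀ x : C, (φ x.1).1.length < m + 1 := fun x =>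
      Nat.lt_succ_of_le (Nat.le_floor (hC x.1 x.2))
    let g : C → (Σ i : Fin (m + 1), List.Vector (Fin K) i) := fun x =>
      ⟨⟨(φ x.1).1.length, hlen x⟩, ⟨(φ x.1).1, rfl⟩⟩
    have hg : Function.Injective g := by
      intro x y hxy
      have h3 := congrArg (fun s : (Σ i : Fin (m + 1), List.Vector (Fin K) i) => s.2.1) hxy
      exact Subtype.ext (hinj x.2 y.2 (Subtype.ext h3))
    have hfin : Finite C := Finite.of_injective g hg
    refine ⟨Set.toFinite C, ?_⟩
    have h1 : Nat.card C ≤ ∑ i : Fin (m + 1), K ^ (i : ℕ) := by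
      refine (Nat.card_le_card_of_injective g hg).trans (le_of_eq ?_)
      rw [Nat.card_eq_fintype_card, Fintype.card_sigma]
      simp [card_vector]
    have h2 : ∑ i : Fin (m + 1), K ^ (i : ℕ) ≤ K ^ (m + 1) := by
      rw [Fin.sum_univ_eq_sum_range (fun i => K ^ i)]
      exact (Nat.geomSum_lt hK (fun k hk => by simpa using hk)).le
    rw [Nat.card_coe_set_eq] at h1
    have h3 : (C.ncard : ℝ) ≤ (K : ℝ) ^ (m + 1) := by exact_mod_cast h1.trans h2
    refine h3.trans ?_
    rw [← Real.rpow_natCast]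
    refine Real.rpow_le_rpow_of_exponent_le hK1.le ?_
    push_cast
    have := Nat.floor_le ht
    linarith

end codes

/-- converse, one shot -/
lemma converse_oneshot {α : Type*} (K : ℕ) (hK : 2 ≤ K) (n : ℕ) (hn : 1 ≤ n) (P : Dist α)
    (R L γ : ℝ) (φ : α → Word K) (ψ : Word K → α) :
    P.pr (Gset K n P R (L + γ) {x | ψ (φ x) = x}) ≤
      ovP P φ ((n : ℝ) * R + Real.sqrt (n : ℝ) * L) + (K : ℝ) ^ (1 - Real.sqrt (n : ℝ) * γ) := by
  have hK1 : (1 : ℝ) < K := by exact_mod_cast (by omega : 1 < K)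
  have hK0 : (0 : ℝ) < K := by linarith
  set A : Set α := {x | ψ (φ x) = x} with hA
  set t := (n : ℝ) * R + Real.sqrt (n : ℝ) * L with ht
  set t' := (n : ℝ) * R + Real.sqrt (n : ℝ) * (L + γ) with ht'
  set C : Set α := {x | x ∈ A ∧ wlen (φ x) ≤ t ∧ P.p x ≤ 1 / (K : ℝ) ^ t'} with hC
  have hsub : Gset K n P R (L + γ) A ⊆ ({x | wlen (φ x) > t} ∪ C) ∪ {x | P.p x = 0} := by
    rintro x ⟨hxA, hx⟩
    by_cases h0 : P.p x = 0
    · right; exact h0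
    left
    by_cases hl : wlen (φ x) > t
    · left; exact hl
    right
    have hp : 0 < P.p x := lt_of_le_of_ne (P.nonneg x) (Ne.symm h0)
    have ha : 0 < P.pr A := hp.trans_le (p_le_pr P hxA)
    have := (cond_iff K hK n hn R (L + γ) _ _ hp ha).1 hx
    refine ⟨hxA, not_lt.1 hl, this.trans ?_⟩
    have := pr_le_one P A
    gcongr
  have hinj : Set.InjOn φ C := by
    intro x hx y hy hxy
    have h1 : ψ (φ x) = x := hx.1
    have h2 : ψ (φ y) = y := hy.1
    rw [← h1, ← h2, hxy]
  obtain ⟨hf, hc⟩ := count_words K hK φ C hinj t (fun x hx => hx.2.1)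
  have h1 := pr_le_card P C hf (1 / (K : ℝ) ^ t') (fun x hx => hx.2.2)
  have h2 : (C.ncard : ℝ) * (1 / (K : ℝ) ^ t') ≤ (K : ℝ) ^ (1 - Real.sqrt (n : ℝ) * γ) := by
    have e : (K : ℝ) ^ (1 - Real.sqrt (n : ℝ) * γ) = (K : ℝ) ^ (t + 1) * (1 / (K : ℝ) ^ t') := by
      rw [mul_one_div, ← Real.rpow_sub hK0]
      congr 1
      rw [ht, ht']; ring
    rw [e]
    gcongr
  have h3 := pr_mono P hsub
  have h4 := pr_union_le P ({x | wlen (φ x) > t} ∪ C) {x | P.p x = 0}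
  have h5 := pr_union_le P {x | wlen (φ x) > t} C
  have h6 := pr_null P
  unfold ovP
  linarith

/-- achievability, one shot -/
lemma direct_oneshot {α : Type*} [Countable α] [Nonempty α] (K : ℕ) (hK : 2 ≤ K) (n : ℕ)
    (hn : 1 ≤ n) (P : Dist α) (R L γ : ℝ) (hγ : 1 ≤ Real.sqrt (n : ℝ) * γ) (A : Set α)
    (hA : P.pr (Gset K n P R L A) < P.pr A) :
    ∃ (φ : α → Word K) (ψ : Word K → α), errP P φ ψ ≤ 1 - P.pr A ∧
      ovP P φ ((n : ℝ) * R + Real.sqrt (n : ℝ) * (L + γ)) ≤ P.pr (Gset K n P R L A) := by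
  have hK1 : (1 : ℝ) < K := by exact_mod_cast (by omega : 1 < K)
  have hK0 : (0 : ℝ) < K := by linarith
  set t := (n : ℝ) * R + Real.sqrt (n : ℝ) * L with ht
  set t' := (n : ℝ) * R + Real.sqrt (n : ℝ) * (L + γ) with ht'
  have htt : t + 1 ≤ t' := by rw [ht, ht']; linarith
  have ha : 0 < P.pr A := (pr_nonneg _ _).trans_lt hA
  set B : Set α := {x | x ∈ A ∧ x ∉ Gset K n P R L A ∧ P.p x ≠ 0} with hB
  have hBA : B ⊆ A := fun x hx => hx.1
  have hcov : A \ B ⊆ Gset K n P R L A ∪ {x | P.p x = 0} := by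
    rintro x ⟨hxA, hxB⟩
    by_cases h0 : P.p x = 0
    · right; exact h0
    by_cases hg : x ∈ Gset K n P R L A
    · left; exact hg
    exact absurd ⟨hxA, hg, h0⟩ hxB
  have hpAB : P.pr (A \ B) ≤ P.pr (Gset K n P R L A) := by
    have := pr_mono P hcov
    have h2 := pr_union_le P (Gset K n P R L A) {x | P.p x = 0}
    have h3 := pr_null P
    linarith
  have hMpos : 0 < (K : ℝ) ^ t := Real.rpow_pos_of_pos hK0 _
  obtain ⟨hfin, hcard⟩ := finite_of_lower P hBA ha ((K : ℝ) ^ t) hMpos (by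
    intro x hx
    have hp : 0 < P.p x := lt_of_le_of_ne (P.nonneg x) (Ne.symm hx.2.2)
    have h1 : ¬ (P.p x ≤ P.pr A / (K : ℝ) ^ t) := fun h =>
      hx.2.1 ⟨hx.1, (cond_iff K hK n hn R L _ _ hp ha).2 h⟩
    exact (not_le.1 h1).le)
  have hBne : B.Nonempty := by
    rw [Set.nonempty_iff_ne_empty]
    intro h
    rw [h, Set.diff_empty] at hpAB
    linarith
  have hB1 : (1 : ℝ) ≤ B.ncard := by
    exact_mod_cast (Set.ncard_pos hfin).2 hBne
  have ht0 : 0 ≤ t := by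
    by_contra h
    have := Real.rpow_lt_one_of_one_lt_of_neg hK1 (not_le.1 h)
    linarith
  have hm1 : 1 ≤ ⌊t'⌋₊ := Nat.le_floor (by push_cast; linarith)
  have hmc : B.ncard ≤ K ^ ⌊t'⌋₊ := by
    have h1 : (B.ncard : ℝ) ≤ (K : ℝ) ^ ⌊t'⌋₊ := by
      refine hcard.trans ?_
      rw [← Real.rpow_natCast]
      refine Real.rpow_le_rpow_of_exponent_le hK1.le ?_
      have := Nat.lt_floor_add_one t'
      linarith
    exact_mod_cast h1
  obtain ⟨φ, ψ, h1, h2⟩ := code_exists K hK A B hBA hfin ⌊t'⌋₊ hm1 hmc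
  refine ⟨φ, ψ, ?_, ?_⟩
  · have h3 : {x | ψ (φ x) ≠ x} ⊆ Aᶜ := fun x hx hxA => hx (h1 x hxA)
    have h4 := pr_mono P h3
    have h5 := pr_compl P A
    unfold errP
    linarith
  · refine (pr_mono P ?_).trans hpAB
    intro x hx
    refine h2 x ?_
    have hx' : t' < ((φ x).1.length : ℝ) := hx
    have : (⌊t'⌋₊ : ℝ) ≤ t' := Nat.floor_le (by linarith)
    exact_mod_cast this.trans_lt hx'

lemma diag (Q : ℕ → ℕ → Prop) (h : ∀ k, ∀ᶠ n in atTop, Q k n) :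
    ∃ κ : ℕ → ℕ, Tendsto κ atTop atTop ∧ ∀ᶠ n in atTop, Q (κ n) n := by
  classical
  refine ⟨fun n => Nat.findGreatest (fun k => Q k n) n, ?_, ?_⟩
  · rw [tendsto_atTop]
    intro k
    filter_upwards [h k, eventually_ge_atTop k] with n hn hk
    exact Nat.le_findGreatest hk hn
  · filter_upwards [h 0] with n hn
    exact Nat.findGreatest_spec (P := fun k => Q k n) (Nat.zero_le n) hn

lemma sInf_eq_of_approx (S T : Set ℝ) (h1 : ∀ a ∈ S, ∀ γ > 0, a + γ ∈ T)
    (h2 : ∀ a ∈ T, ∀ γ > 0, a + γ ∈ S) : sInf S = sInf T := by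
  have key : ∀ S T : Set ℝ, (∀ a ∈ S, ∀ γ > 0, a + γ ∈ T) → (∀ a ∈ T, ∀ γ > 0, a + γ ∈ S) →
      lowerBounds S ⊆ lowerBounds T := by
    intro S T _ h2 b hb a ha
    exact le_of_forall_pos_le_add (fun γ hγ => hb (h2 a ha γ hγ))
  have hl : lowerBounds S = lowerBounds T :=
    Set.Subset.antisymm (key S T h1 h2) (key T S h2 h1)
  rcases S.eq_empty_or_nonempty with hS | ⟨s, hs⟩
  · have : T = ∅ := by
      ext x
      simp only [Set.mem_empty_iff_false, iff_false]
      intro hx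
      have := h2 x hx 1 one_pos
      rw [hS] at this
      exact this
    rw [hS, this]
  · have hT : T.Nonempty := ⟨_, h1 s hs 1 one_pos⟩
    by_cases hb : BddBelow S
    · have hbT : BddBelow T := by
        obtain ⟨b, hb⟩ := hb
        exact ⟨b, hl ▸ hb⟩
      have g1 := isGLB_csInf ⟨s, hs⟩ hb
      have g2 := isGLB_csInf hT hbT
      unfold IsGLB at g1
      rw [hl] at g1
      exact IsGLB.unique g1 g2
    · have hbT : ¬ BddBelow T := by
        rintro ⟨b, hb'⟩
        exact hb ⟨b, hl ▸ hb'⟩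
      rw [Real.sInf_of_not_bddBelow hb, Real.sInf_of_not_bddBelow hbT]

lemma sqrt_tendsto (γ : ℝ) (hγ : 0 < γ) :
    Tendsto (fun n : ℕ => Real.sqrt (n : ℝ) * γ) atTop atTop :=
  Tendsto.atTop_mul_const hγ (Real.tendsto_sqrt_atTop.comp tendsto_natCast_atTop_atTop)

lemma src_nonempty {𝒳 : Type*} (X : Source 𝒳) (n : ℕ) : Nonempty (Fin n → 𝒳) := by
  by_contra h
  rw [not_nonempty_iff] at h
  have h1 := (X n).hasSum
  have h2 := h1.tsum_eq
  rw [tsum_empty] at h2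
  exact zero_ne_one h2

/-- second-order (ε,δ,R)-optimum threshold, general formula. -/
theorem statement11 {𝒳 : Type*} [Countable 𝒳] (K : ℕ) (hK : 2 ≤ K) (X : Source 𝒳)
    (R ε δ : ℝ) (hR : 0 ≤ R)
    (hε0 : 0 ≤ ε) (hε1 : ε < 1) (hδ0 : 0 ≤ δ) (hδ1 : δ < 1) (hεδ : ε + δ < 1) :
    Lopt K X ε δ R = Gsecond K X ε δ R := by
  have hK1 : (1 : ℝ) < K := by exact_mod_cast (by omega : 1 < K)
  have herr : ∀ (φ : ∀ n, (Fin n → 𝒳) → Word K) (ψ : ∀ n, Word K → (Fin n → 𝒳)) (c : ℝ),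
      limsup (fun n => errP (X n) (φ n) (ψ n)) atTop ≤ c ↔
        ∀ η > 0, ∀ᶠ n in atTop, errP (X n) (φ n) (ψ n) ≤ c + η := fun φ ψ c =>
    limsup_le_iff' _ (fun n => pr_nonneg _ _) (fun n => pr_le_one _ _) c
  have hov : ∀ (φ : ∀ n, (Fin n → 𝒳) → Word K) (L c : ℝ),
      limsup (fun n => ovP (X n) (φ n) ((n : ℝ) * R + Real.sqrt (n : ℝ) * L)) atTop ≤ c ↔
        ∀ η > 0, ∀ᶠ n in atTop,
          ovP (X n) (φ n) ((n : ℝ) * R + Real.sqrt (n : ℝ) * L) ≤ c + η := fun φ L c =>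
    limsup_le_iff' _ (fun n => pr_nonneg _ _) (fun n => pr_le_one _ _) c
  have hG : Gsecond K X ε δ R =
      sInf {L | ∀ ν > 0, ∀ᶠ n in atTop, gfun K n (X n) ε ν R L ≤ δ + ν} := by
    unfold Gsecond
    congr 1
    ext L
    exact gsec_iff K X R ε δ L hε0
  rw [hG]
  unfold Lopt
  refine sInf_eq_of_approx _ _ ?_ ?_
  · rintro L ⟨φ, ψ, h1, h2⟩ γ hγ ν hν
    rw [herr] at h1
    rw [hov] at h2
    have hlim : Tendsto (fun n : ℕ => (K : ℝ) ^ (1 - Real.sqrt (n : ℝ) * γ)) atTop (nhds 0) := by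
      refine (tendsto_rpow_atBot_of_base_gt_one _ hK1).comp ?_
      have := tendsto_atBot_add_const_left atTop (1 : ℝ)
        (tendsto_neg_atTop_atBot.comp (sqrt_tendsto γ hγ))
      simpa [sub_eq_add_neg] using this
    have hsm := hlim.eventually (ge_mem_nhds (half_pos hν))
    filter_upwards [h1 ν hν, h2 (ν / 2) (half_pos hν), hsm, eventually_ge_atTop 1]
      with n e1 e2 e3 hn
    have hc := converse_oneshot K hK n hn (X n) R L γ (φ n) (ψ n)
    have hA : (X n).pr {x | ψ n (φ n x) = x} ≥ 1 - ε - ν := by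
      have h3 := pr_compl (X n) {x | ψ n (φ n x) = x}
      have h4 : (X n).pr {x | ψ n (φ n x) = x}ᶜ ≤ ε + ν := e1
      linarith
    have := gfun_le K n (X n) ε ν R (L + γ) _ hA
    linarith
  · intro L hL γ hγ
    have hL' : ∀ ν > 0, ∀ᶠ n in atTop, gfun K n (X n) ε ν R L ≤ δ + ν := hL
    obtain ⟨k0, hk0⟩ := exists_nat_one_div_lt (show (0 : ℝ) < (1 - ε - δ) / 4 by linarith)
    -- the vanishing slack
    let s : ℕ → ℝ := fun k => 1 / ((k : ℝ) + 1)
    have hs0 : ∀ k, 0 < s k := fun k => by positivity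
    have hslim : Tendsto s atTop (nhds 0) := tendsto_one_div_add_atTop_nhds_zero_nat
    let Q : ℕ → ℕ → Prop := fun k n => ∃ (φ : (Fin n → 𝒳) → Word K) (ψ : Word K → (Fin n → 𝒳)),
      errP (X n) φ ψ ≤ ε + s k ∧
      ovP (X n) φ ((n : ℝ) * R + Real.sqrt (n : ℝ) * (L + γ)) ≤ δ + s k
    have hQ : ∀ k, ∀ᶠ n in atTop, Q k n := by
      intro k
      have hν : 0 < min (s k / 2) ((1 - ε - δ) / 4) :=
        lt_min (half_pos (hs0 k)) (by linarith)
      filter_upwards [hL' _ hν, eventually_ge_atTop 1,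
        (sqrt_tendsto γ hγ).eventually_ge_atTop 1] with n e1 hn e2
      haveI := src_nonempty X n
      set ν := min (s k / 2) ((1 - ε - δ) / 4) with hνd
      have m1 : ν ≤ s k / 2 := min_le_left _ _
      have m2 : ν ≤ (1 - ε - δ) / 4 := min_le_right _ _
      obtain ⟨A, hA1, hA2⟩ := gfun_exists K n (X n) ε ν R L (δ + 2 * ν) hε0 hν.le (by linarith)
      obtain ⟨φ, ψ, c1, c2⟩ := direct_oneshot K hK n hn (X n) R L γ e2 A (by linarith)
      exact ⟨φ, ψ, by linarith [hs0 k], by linarith⟩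
    obtain ⟨κ, hκ, hκQ⟩ := diag Q hQ
    have hall : ∀ n, ∃ (φ : (Fin n → 𝒳) → Word K) (ψ : Word K → (Fin n → 𝒳)), Q (κ n) n →
        errP (X n) φ ψ ≤ ε + s (κ n) ∧
        ovP (X n) φ ((n : ℝ) * R + Real.sqrt (n : ℝ) * (L + γ)) ≤ δ + s (κ n) := by
      intro n
      by_cases h : Q (κ n) n
      · obtain ⟨φ, ψ, h'⟩ := h
        exact ⟨φ, ψ, fun _ => h'⟩
      · haveI := src_nonempty X n
        exact ⟨fun _ => ⟨[⟨0, by omega⟩], by simp⟩, fun _ => Classical.arbitrary _,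
          fun h' => absurd h' h⟩
    choose φ ψ hφψ using hall
    have hsκ : ∀ η > 0, ∀ᶠ n in atTop, s (κ n) ≤ η := fun η hη =>
      (hslim.comp hκ).eventually (ge_mem_nhds hη)
    refine ⟨φ, ψ, (herr φ ψ ε).2 ?_, (hov φ (L + γ) δ).2 ?_⟩
    · intro η hη
      filter_upwards [hκQ, hsκ η hη] with n a b
      have := (hφψ n a).1
      linarith
    · intro η hη
      filter_upwards [hκQ, hsκ η hη] with n a b
      have := (hφψ n a).2
      linarith
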